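/- arXiv:2104.09249 — 3 statements merged into one kernel-verified Lean document; each statement's English description precedes it below -/
import Mathlib

section
/- Let p be a list of edges of a graph with nonnegative edge latencies l, let T > 0 be a latency bound, ε > 0, and let D ≥ 1 be an upper bound on the number of edges of p (i.e. |p| ≤ D). Set the scaling parameter θ = ε·T/D. If p is scaled-feasible, i.e. ∑_{e ∈ p} ⌊l(e)/θ⌋ ≤ ⌊T/θ⌋, then the true total latency of p violates the bound by at most a factor 1+ε: L(p) = ∑_{e ∈ p} l(e) ≤ (1+ε)·T. -/
/-- Rounding each latency down to a multiple of `θ` loses at most `θ` per edge. -/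
theorem sum_le_mul_sum_floor_add_length {E : Type*} (l : E → ℝ) {θ : ℝ} (hθ : 0 < θ)
    (p : List E) :
    (p.map l).sum ≤ θ * (((p.map fun e => ⌊l e / θ⌋₊).sum : ℕ) + p.length) := by
  induction p with
  | nil => simp
  | cons e p ih =>
    have h : l e < (⌊l e / θ⌋₊ + 1) * θ := (div_lt_iff₀ hθ).mp (Nat.lt_floor_add_one _)
    simp only [List.map_cons, List.sum_cons, List.length_cons, Nat.cast_add, Nat.cast_one]
    linarith

/-- With scaling parameter `θ = ε·T/D`, where `D ≥ 1` bounds the number of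
edges of `p`, a scaled-feasible path violates the true latency bound by at most a factor
`1 + ε`: if `∑_{e ∈ p} ⌊l(e)/θ⌋ ≤ ⌊T/θ⌋` then `∑_{e ∈ p} l(e) ≤ (1+ε)·T`. -/
theorem scaled_feasible_imp_approx_latency_feasible
    {E : Type*} (l : E → ℝ) (hl : ∀ e, 0 ≤ l e)
    (p : List E) (T : ℝ) (hT : 0 < T) (ε : ℝ) (hε : 0 < ε)
    (D : ℕ) (hD : 1 ≤ D) (hlen : p.length ≤ D)
    (θ : ℝ) (hθ : θ = ε * T / D)
    (hscaled : (p.map fun e => ⌊l e / θ⌋₊).sum ≤ ⌊T / θ⌋₊) :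
    (p.map l).sum ≤ (1 + ε) * T := by
  have hD_pos : (0 : ℝ) < D := by exact_mod_cast hD
  have hθ_pos : 0 < θ := hθ ▸ by positivity
  have hsum : (((p.map fun e => ⌊l e / θ⌋₊).sum : ℕ) : ℝ) ≤ T / θ :=
    (Nat.cast_le.mpr hscaled).trans (Nat.floor_le (by positivity))
  have hlen' : (p.length : ℝ) ≤ D := by exact_mod_cast hlen
  calc (p.map l).sum
      ≤ θ * (((p.map fun e => ⌊l e / θ⌋₊).sum : ℕ) + p.length) :=
        sum_le_mul_sum_floor_add_length l hθ_pos p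
    _ ≤ θ * (T / θ + D) := by gcongr
    _ = T + θ * D := by field_simp
    _ = (1 + ε) * T := by
      rw [hθ]
      field_simp
end

section
/- Let G be a finite directed graph with nonnegative edge latencies l and nonnegative edge costs c, let s, t be vertices, T > 0 a latency bound, ε > 0, and let D ≥ 1 be an upper bound on the number of edges of any simple path in G. Set θ = ε·T/D and suppose some simple s–t path q satisfies L(q) ≤ T. Let p* be a simple s–t path of minimum cost among all simple s–t paths p with scaled latency ∑_{e ∈ p} ⌊l(e)/θ⌋ ≤ ⌊T/θ⌋. Then p* satisfies: (i) C(p*) ≤ C_opt, the minimum cost of any simple s–t path with L(p) ≤ T, and (ii) L(p*) ≤ (1+ε)·T. -/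
/-- `IsWalkFrom E s t p` : the list of edges `p` forms a walk from `s` to `t`
in the directed graph with adjacency relation `E`. -/
def IsWalkFrom {V : Type*} (E : V → V → Prop) : V → V → List (V × V) → Prop
  | s, t, [] => s = t
  | s, t, e :: p => e.1 = s ∧ E e.1 e.2 ∧ IsWalkFrom E e.2 t p

/-- A simple path from `s` to `t`: a walk whose vertex sequence has no repeats. -/
def IsSimplePathFrom {V : Type*} (E : V → V → Prop) (s t : V) (p : List (V × V)) : Prop :=
  IsWalkFrom E s t p ∧ (s :: p.map Prod.snd).Nodup

/-- The sum of the floors is at most the floor of the sum. -/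
theorem sum_floor_div_le_floor_div {α : Type*} {l : α → ℝ} (hl : ∀ e, 0 ≤ l e)
    {θ T : ℝ} (hθ : 0 < θ) {p : List α} (hp : (p.map l).sum ≤ T) :
    (p.map fun e => ⌊l e / θ⌋₊).sum ≤ ⌊T / θ⌋₊ := by
  have key : ∀ p : List α,
      (((p.map fun e => ⌊l e / θ⌋₊).sum : ℕ) : ℝ) ≤ (p.map l).sum / θ := by
    intro p
    induction p with
    | nil => simp
    | cons e p ih =>
      have := Nat.floor_le (div_nonneg (hl e) hθ.le)
      simp only [List.map_cons, List.sum_cons, Nat.cast_add, add_div]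
      linarith
  exact Nat.le_floor ((key p).trans (by gcongr))

/-- Rounding down to multiples of `θ` loses at most `θ` per list entry. -/
theorem sum_le_mul_sum_floor_div_add_length {α : Type*} (l : α → ℝ)
    {θ : ℝ} (hθ : 0 < θ) (p : List α) :
    (p.map l).sum ≤ θ * (((p.map fun e => ⌊l e / θ⌋₊).sum : ℕ) + p.length) := by
  induction p with
  | nil => simp
  | cons e p ih =>
    have h := (div_lt_iff₀ hθ).1 (Nat.lt_floor_add_one (l e / θ))
    simp only [List.map_cons, List.sum_cons, List.length_cons, Nat.cast_add, Nat.cast_one]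
    linarith

/-- value-level content of Goel et al.'s theorem: with `θ = ε·T/D`, where
`D ≥ 1` bounds the number of edges of any simple path, any simple `s`–`t` path `pstar`
of minimum cost among the scaled-feasible simple `s`–`t` paths has cost at most the cost
of every latency-feasible simple `s`–`t` path (i.e. at most `C_opt`), and its latency
violates the bound by at most a factor `1 + ε`. -/
theorem goel_min_scaled_path_cost_and_latency
    {V : Type*} [Fintype V] [DecidableEq V]
    (E : V → V → Prop) (l c : V × V → ℝ)
    (hl : ∀ e, 0 ≤ l e) (hc : ∀ e, 0 ≤ c e)
    (s t : V) (T : ℝ) (hT : 0 < T) (ε : ℝ) (hε : 0 < ε)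
    (D : ℕ) (hD : 1 ≤ D)
    (hbound : ∀ u v : V, ∀ p, IsSimplePathFrom E u v p → p.length ≤ D)
    (θ : ℝ) (hθ : θ = ε * T / D)
    (hfeas : ∃ q, IsSimplePathFrom E s t q ∧ (q.map l).sum ≤ T)
    (pstar : List (V × V))
    (hps : IsSimplePathFrom E s t pstar)
    (hps_scaled : (pstar.map fun e => ⌊l e / θ⌋₊).sum ≤ ⌊T / θ⌋₊)
    (hps_min : ∀ p, IsSimplePathFrom E s t p →
      (p.map fun e => ⌊l e / θ⌋₊).sum ≤ ⌊T / θ⌋₊ →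
      (pstar.map c).sum ≤ (p.map c).sum) :
    (∀ p, IsSimplePathFrom E s t p → (p.map l).sum ≤ T →
      (pstar.map c).sum ≤ (p.map c).sum)
    ∧ (pstar.map l).sum ≤ (1 + ε) * T := by
  have hD0 : (0 : ℝ) < D := by exact_mod_cast hD
  have hθ0 : 0 < θ := by rw [hθ]; positivity
  refine ⟨fun p hp hpT => hps_min p hp (sum_floor_div_le_floor_div hl hθ0 hpT), ?_⟩
  have hlen : (pstar.length : ℝ) ≤ D := by exact_mod_cast hbound s t pstar hps
  have hscaled : (((pstar.map fun e => ⌊l e / θ⌋₊).sum : ℕ) : ℝ) ≤ T / θ :=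
    (Nat.cast_le.2 hps_scaled).trans (Nat.floor_le (by positivity))
  calc (pstar.map l).sum
      ≤ θ * (((pstar.map fun e => ⌊l e / θ⌋₊).sum : ℕ) + pstar.length) :=
        sum_le_mul_sum_floor_div_add_length l hθ0 pstar
    _ ≤ θ * (T / θ + D) := by gcongr
    _ = T + θ * D := by field_simp
    _ = (1 + ε) * T := by rw [hθ]; field_simp
end

section
/- Let G be a finite directed graph with nonnegative edge latencies l and nonnegative edge costs c, let s, t be vertices, T ≥ 0 a latency bound, and θ > 0 a cost-scaling parameter. Suppose some simple s–t path satisfies L(p) ≤ T, and let D ≥ 1 bound the number of edges of any simple path in G. Let p' be a simple s–t path minimizing the scaled cost ∑_{e ∈ p} ⌊c(e)/θ⌋ among all latency-feasible simple s–t paths. Then C(p') ≤ C_opt + θ·D, where C_opt is the minimum true cost of a latency-feasible simple s–t path. In particular, if L_B > 0 is a lower bound on C_opt and θ = ε·L_B/D for some ε > 0, then C(p') ≤ (1+ε)·C_opt. -/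
/-- Rounding costs down to multiples of `θ` does not increase the total cost. -/
theorem mul_sum_floor_div_le {α : Type*} {c : α → ℝ} {θ : ℝ} (hc : ∀ e, 0 ≤ c e) (hθ : 0 < θ)
    (p : List α) : θ * ((p.map fun e => ⌊c e / θ⌋₊).sum : ℕ) ≤ (p.map c).sum := by
  induction p with
  | nil => simp
  | cons e p ih =>
    have h := (le_div_iff₀' hθ).1 (Nat.floor_le (div_nonneg (hc e) hθ.le))
    simp only [List.map_cons, List.sum_cons, Nat.cast_add, mul_add]
    exact add_le_add h ih

/-- Rounding costs down to multiples of `θ` loses at most `θ` per element. -/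
theorem sum_le_mul_sum_floor_div_add {α : Type*} (c : α → ℝ) {θ : ℝ} (hθ : 0 < θ)
    (p : List α) :
    (p.map c).sum ≤ θ * ((p.map fun e => ⌊c e / θ⌋₊).sum : ℕ) + θ * p.length := by
  induction p with
  | nil => simp
  | cons e p ih =>
    have h := (div_le_iff₀' hθ).1 (Nat.lt_floor_add_one (c e / θ)).le
    simp only [List.map_cons, List.sum_cons, List.length_cons, Nat.cast_add, Nat.cast_one, mul_add]
      at h ⊢
    linarith

/-- cost-scaling core of Hassin / Lorenz–Raz: if `p'` is a latency-feasible
simple `s`–`t` path minimizing the scaled cost `∑ ⌊c(e)/θ⌋` among all latency-feasible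
simple `s`–`t` paths, then `C(p') ≤ C_opt + θ·D`; in particular, if `L_B > 0` is a lower
bound on `C_opt` and `θ = ε·L_B/D`, then `C(p') ≤ (1+ε)·C_opt`. -/
theorem cost_scaling_approximation
    {V : Type*} [Fintype V] [DecidableEq V]
    (E : V → V → Prop) (l c : V × V → ℝ)
    (hl : ∀ e, 0 ≤ l e) (hc : ∀ e, 0 ≤ c e)
    (s t : V) (T : ℝ) (hT : 0 ≤ T) (θ : ℝ) (hθ : 0 < θ)
    (D : ℕ) (hD : 1 ≤ D)
    (hbound : ∀ u v : V, ∀ p, IsSimplePathFrom E u v p → p.length ≤ D)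
    (hfeas : ∃ p, IsSimplePathFrom E s t p ∧ (p.map l).sum ≤ T)
    (p' : List (V × V))
    (hp' : IsSimplePathFrom E s t p') (hp'_feas : (p'.map l).sum ≤ T)
    (hp'_min : ∀ p, IsSimplePathFrom E s t p → (p.map l).sum ≤ T →
      (p'.map fun e => ⌊c e / θ⌋₊).sum ≤ (p.map fun e => ⌊c e / θ⌋₊).sum) :
    (p'.map c).sum ≤
      sInf {x : ℝ | ∃ p, IsSimplePathFrom E s t p ∧ (p.map l).sum ≤ T ∧ (p.map c).sum = x}
        + θ * D
    ∧ ∀ LB ε : ℝ, 0 < LB → 0 < ε →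
      LB ≤ sInf {x : ℝ | ∃ p, IsSimplePathFrom E s t p ∧ (p.map l).sum ≤ T ∧
          (p.map c).sum = x} →
      θ = ε * LB / D →
      (p'.map c).sum ≤ (1 + ε) *
        sInf {x : ℝ | ∃ p, IsSimplePathFrom E s t p ∧ (p.map l).sum ≤ T ∧
            (p.map c).sum = x} := by
  have hmain : (p'.map c).sum ≤
      sInf {x : ℝ | ∃ p, IsSimplePathFrom E s t p ∧ (p.map l).sum ≤ T ∧ (p.map c).sum = x}
        + θ * D := by
    rw [← sub_le_iff_le_add]
    refine le_csInf (hfeas.imp' (fun p => (p.map c).sum) fun p hp => ⟨p, hp.1, hp.2, rfl⟩) ?_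
    rintro _ ⟨p, hp, hpT, rfl⟩
    have hlen : θ * (p'.length : ℝ) ≤ θ * D := by
      gcongr
      exact hbound s t p' hp'
    have hmin : θ * ((p'.map fun e => ⌊c e / θ⌋₊).sum : ℕ) ≤
        θ * ((p.map fun e => ⌊c e / θ⌋₊).sum : ℕ) := by
      gcongr
      exact hp'_min p hp hpT
    linarith [sum_le_mul_sum_floor_div_add c hθ p', mul_sum_floor_div_le hc hθ p]
  refine ⟨hmain, fun LB ε _ hε hLB hθ_eq => hmain.trans ?_⟩
  have hD0 : (D : ℝ) ≠ 0 := Nat.cast_ne_zero.2 (Nat.one_le_iff_ne_zero.1 hD)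
  rw [hθ_eq, div_mul_cancel₀ _ hD0, add_mul, one_mul]
  gcongr
end
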